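/- arXiv:2004.14760 — 2 statements merged into one kernel-verified Lean document; each statement's English description precedes it below -/
import Mathlib

section
/- Let m ≥ 5 and let c_{i,j} ∈ {0,1} for 1 ≤ j < i ≤ m be arbitrary. Let P = {(n/2^m, μ(n)) : n = 0,1,…,2^m−1}, where μ(n) = Σ_{i=1}^m ((c_{i,1}e₁ + ⋯ + c_{i,i−1}e_{i−1} + e_i) mod 2)/2^i. Then disp(P) ≥ (5/2)·(1/2^m); concretely, there is an axis-parallel box of area at least (5/2)·(1/2^m) inside [0,1]² containing no point of P. -/
/-- The set of areas of axis-parallel half-open boxes `[x1,y1) x [x2,y2)` inside `[0,1]^2`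
containing no point of `P`. -/
def emptyBoxAreas (P : Set (ℝ × ℝ)) : Set ℝ :=
  { A | ∃ x₁ y₁ x₂ y₂ : ℝ,
      0 ≤ x₁ ∧ x₁ ≤ y₁ ∧ y₁ ≤ 1 ∧ 0 ≤ x₂ ∧ x₂ ≤ y₂ ∧ y₂ ≤ 1 ∧
      (∀ p ∈ P, p ∉ Set.Ico x₁ y₁ ×ˢ Set.Ico x₂ y₂) ∧
      A = (y₁ - x₁) * (y₂ - x₂) }

/-- The dispersion of a point set `P ⊆ [0,1]^2`: the supremum of areas of empty
axis-parallel boxes. -/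
noncomputable def disp (P : Set (ℝ × ℝ)) : ℝ := sSup (emptyBoxAreas P)
/-- The `i`-th digit (1-based) of `n` in base `b`, with the convention that the
`0`-th digit is `0`. -/
def nthDigit (b n i : ℕ) : ℕ := if i = 0 then 0 else n / b ^ (i - 1) % b
/-- The second-coordinate map of a dyadic NLT net whose diagonal entries are all `1`:
`μ(n) = Σ_{i=1}^m ((c_{i,1}e₁ + ⋯ + c_{i,i-1}e_{i-1} + e_i) mod 2)/2^i`. -/
noncomputable def nltMap2 (m : ℕ) (c : ℕ → ℕ → ℕ) (n : ℕ) : ℝ :=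
  ∑ i ∈ Finset.Icc 1 m,
    (((∑ j ∈ Finset.Icc 1 (i - 1), c i j * nthDigit 2 n j + nthDigit 2 n i) % 2 : ℕ) : ℝ)
      / (2 : ℝ) ^ i

/-- `32` times the second coordinate of the `n`-th point for `m = 5`. -/
def mu5 (a b c d e f g h i j n : ℕ) : ℕ :=
  let e1 := n / 1 % 2
  let e2 := n / 2 % 2
  let e3 := n / 4 % 2
  let e4 := n / 8 % 2
  let e5 := n / 16 % 2
  16 * (e1 % 2) + 8 * ((a * e1 + e2) % 2) + 4 * ((b * e1 + c * e2 + e3) % 2)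
    + 2 * ((d * e1 + e * e2 + f * e3 + e4) % 2)
    + (g * e1 + h * e2 + i * e3 + j * e4 + e5) % 2

/-- Candidate boxes `(x₁, y₁, x₂, y₂)`, in units of `1/32`. -/
def boxes5 : List (ℕ × ℕ × ℕ × ℕ) :=
  [(14, 18, 1, 21), (14, 17, 1, 28), (15, 18, 1, 28), (12, 20, 1, 11), (10, 17, 10, 22),
   (11, 15, 10, 30), (2, 9, 10, 22), (3, 7, 10, 30), (6, 10, 2, 22), (22, 26, 2, 22),
   (18, 25, 10, 22), (19, 23, 10, 30)]

/-- Boolean check that a box is empty. -/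
def boxEmpty (a b c d e f g h i j : ℕ) (B : ℕ × ℕ × ℕ × ℕ) : Bool :=
  (List.range 32).all fun n =>
    !(Nat.blt B.1 n && Nat.blt n B.2.1 && Nat.blt B.2.2.1 (mu5 a b c d e f g h i j n)
      && Nat.blt (mu5 a b c d e f g h i j n) B.2.2.2)

/-- Boolean check over all matrices. -/
def all5 : Bool :=
  let T := [0, 1]
  T.all fun a => T.all fun b => T.all fun c => T.all fun d => T.all fun e =>
  T.all fun f => T.all fun g => T.all fun h => T.all fun i => T.all fun j =>
    boxes5.any (boxEmpty a b c d e f g h i j)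

lemma all5_true : all5 = true := by decide +kernel

lemma exists_box5 (a b c d e f g h i j : ℕ) (ha : a < 2) (hb : b < 2) (hc : c < 2) (hd : d < 2)
    (he : e < 2) (hf : f < 2) (hg : g < 2) (hh : h < 2) (hi : i < 2) (hj : j < 2) :
    ∃ x y u v : ℕ, x ≤ y ∧ y ≤ 32 ∧ u ≤ v ∧ v ≤ 32 ∧ 80 + x * v + y * u ≤ y * v + x * u ∧
      ∀ n < 32, ¬ (x < n ∧ n < y ∧ u < mu5 a b c d e f g h i j n ∧
        mu5 a b c d e f g h i j n < v) := by
  have key := all5_true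
  have mem : ∀ t : ℕ, t < 2 → t ∈ [0, 1] := by
    intro t ht
    simp only [List.mem_cons, List.not_mem_nil, or_false]; omega
  simp only [all5, List.all_eq_true] at key
  have k := key a (mem a ha) b (mem b hb) c (mem c hc) d (mem d hd) e (mem e he)
    f (mem f hf) g (mem g hg) h (mem h hh) i (mem i hi) j (mem j hj)
  rw [List.any_eq_true] at k
  obtain ⟨B, hB, hE⟩ := k
  have hgood : ∀ B ∈ boxes5, B.1 ≤ B.2.1 ∧ B.2.1 ≤ 32 ∧ B.2.2.1 ≤ B.2.2.2 ∧ B.2.2.2 ≤ 32 ∧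
      80 + B.1 * B.2.2.2 + B.2.1 * B.2.2.1 ≤ B.2.1 * B.2.2.2 + B.1 * B.2.2.1 := by decide
  obtain ⟨g1, g2, g3, g4, g5⟩ := hgood B hB
  refine ⟨B.1, B.2.1, B.2.2.1, B.2.2.2, g1, g2, g3, g4, g5, ?_⟩
  rintro n hn ⟨h1, h2, h3, h4⟩
  unfold boxEmpty at hE
  rw [List.all_eq_true] at hE
  have h5 := hE n (List.mem_range.2 hn)
  have b1 := (Iff.of_eq Nat.blt_eq).2 h1
  have b2 := (Iff.of_eq Nat.blt_eq).2 h2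
  have b3 := (Iff.of_eq Nat.blt_eq).2 h3
  have b4 := (Iff.of_eq Nat.blt_eq).2 h4
  rw [b1, b2, b3, b4] at h5
  exact absurd h5 (by decide)

/-- Numerator digit. -/
def rowVal (c : ℕ → ℕ → ℕ) (n i : ℕ) : ℕ :=
  (∑ j ∈ Finset.Icc 1 (i - 1), c i j * nthDigit 2 n j + nthDigit 2 n i) % 2

lemma nltMap2_eq (m : ℕ) (c : ℕ → ℕ → ℕ) (n : ℕ) :
    nltMap2 m c n = ∑ i ∈ Finset.Icc 1 m, (rowVal c n i : ℝ) / (2 : ℝ) ^ i := rfl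

lemma rowVal_zero (m t : ℕ) (htm : t ≤ m) (c : ℕ → ℕ → ℕ) (n : ℕ)
    (h : nltMap2 m c n < 1 / (2 : ℝ) ^ t) (i : ℕ) (h1 : 1 ≤ i) (hi : i ≤ t) :
    rowVal c n i = 0 := by
  by_contra hne
  have h2 : rowVal c n i = 1 := by
    have : rowVal c n i < 2 := Nat.mod_lt _ (by norm_num)
    omega
  have h3 : (rowVal c n i : ℝ) / (2 : ℝ) ^ i ≤ nltMap2 m c n := by
    rw [nltMap2_eq]
    apply Finset.single_le_sum (f := fun i => (rowVal c n i : ℝ) / (2 : ℝ) ^ i)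
    · intro k _
      positivity
    · exact Finset.mem_Icc.2 ⟨h1, by omega⟩
  rw [h2] at h3
  have h4 : 1 / (2 : ℝ) ^ t ≤ 1 / (2 : ℝ) ^ i :=
    one_div_le_one_div_of_le (by positivity) (pow_le_pow_right₀ (by norm_num) hi)
  push_cast at h3
  linarith

lemma digit_zero (t : ℕ) (c : ℕ → ℕ → ℕ) (n : ℕ)
    (h : ∀ i, 1 ≤ i → i ≤ t → rowVal c n i = 0) :
    ∀ i, i ≤ t → nthDigit 2 n i = 0 := by
  intro i
  induction i using Nat.strong_induction_on with
  | _ i ih =>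
    intro hi
    by_cases h0 : i = 0
    · simp [nthDigit, h0]
    have h1 := h i (by omega) hi
    have hs : ∑ j ∈ Finset.Icc 1 (i - 1), c i j * nthDigit 2 n j = 0 := by
      apply Finset.sum_eq_zero
      intro j hj
      rw [Finset.mem_Icc] at hj
      rw [ih j (by omega) (by omega), mul_zero]
    rw [rowVal, hs, zero_add] at h1
    simp only [nthDigit, h0, if_false] at h1 ⊢
    omega

lemma dvd_of_digit_zero (n : ℕ) : ∀ t, (∀ i, i ≤ t → nthDigit 2 n i = 0) → 2 ^ t ∣ n := by
  intro t
  induction t with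
  | zero => intro _; simp
  | succ t ih =>
    intro h
    obtain ⟨k, hk⟩ := ih fun i hi => h i (by omega)
    have h1 := h (t + 1) le_rfl
    simp only [nthDigit, Nat.add_eq_zero_iff, one_ne_zero, and_false, if_false,
      Nat.add_sub_cancel] at h1
    rw [hk, Nat.mul_div_cancel_left _ (by positivity)] at h1
    obtain ⟨l, hl⟩ := Nat.dvd_of_mod_eq_zero h1
    exact ⟨l, by rw [hk, hl, pow_succ, mul_assoc]⟩

lemma nthDigit_shift (t k i : ℕ) :
    nthDigit 2 (2 ^ t * k) (t + (i + 1)) = k / 2 ^ i % 2 := by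
  have : t + (i + 1) - 1 = t + i := by omega
  rw [nthDigit, if_neg (by omega), this, pow_add, Nat.mul_div_mul_left _ _ (by positivity)]

lemma sum_shift {M : Type*} [AddCommMonoid M] (t r : ℕ) (f : ℕ → M)
    (h : ∀ i, 1 ≤ i → i ≤ t → f i = 0) :
    ∑ i ∈ Finset.Icc 1 (t + r), f i = ∑ i ∈ Finset.range r, f (t + (i + 1)) := by
  induction r with
  | zero =>
    rw [Finset.range_zero, Finset.sum_empty]
    apply Finset.sum_eq_zero
    intro i hi
    rw [Finset.mem_Icc] at hi
    exact h i hi.1 (by omega)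
  | succ r ih =>
    rw [← add_assoc, Finset.sum_Icc_succ_top (by omega), ih, Finset.sum_range_succ, add_assoc]

lemma rowVal_shift (c : ℕ → ℕ → ℕ) (t k r : ℕ)
    (h : ∀ i, i ≤ t → nthDigit 2 (2 ^ t * k) i = 0) :
    rowVal c (2 ^ t * k) (t + (r + 1)) =
      (∑ j ∈ Finset.range r, c (t + (r + 1)) (t + (j + 1)) * (k / 2 ^ j % 2) + k / 2 ^ r % 2) % 2 := by
  have e : t + (r + 1) - 1 = t + r := by omega
  rw [rowVal, e, sum_shift t r _ (fun i _ hi => by rw [h i hi, mul_zero])]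
  simp only [nthDigit_shift]

lemma strip (t : ℕ) (c : ℕ → ℕ → ℕ) (n : ℕ) (hn : n < 2 ^ (t + 5))
    (h : nltMap2 (t + 5) c n < 1 / (2 : ℝ) ^ t) :
    ∃ k < 32, n = 2 ^ t * k ∧
      nltMap2 (t + 5) c n = (mu5 (c (t + 2) (t + 1)) (c (t + 3) (t + 1)) (c (t + 3) (t + 2))
        (c (t + 4) (t + 1)) (c (t + 4) (t + 2)) (c (t + 4) (t + 3))
        (c (t + 5) (t + 1)) (c (t + 5) (t + 2)) (c (t + 5) (t + 3)) (c (t + 5) (t + 4)) k : ℝ)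
        / (32 * 2 ^ t) := by
  have hr := rowVal_zero (t + 5) t (by omega) c n h
  have hd := digit_zero t c n hr
  obtain ⟨k, rfl⟩ := dvd_of_digit_zero n t hd
  refine ⟨k, ?_, rfl, ?_⟩
  · rw [pow_add] at hn
    exact lt_of_mul_lt_mul_left hn (Nat.zero_le _)
  · rw [nltMap2_eq, sum_shift t 5 _ (fun i h1 hi => by rw [hr i h1 hi]; simp)]
    simp only [rowVal_shift c t k _ hd, Finset.sum_range_succ, Finset.sum_range_zero, mu5,
      zero_add, pow_zero, pow_one, Nat.reduceAdd, Nat.reducePow]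
    push_cast
    simp only [pow_add]
    field_simp
    simp only [Nat.div_one, Nat.mod_mod]
    ring

lemma exists_open_box (t : ℕ) (c : ℕ → ℕ → ℕ) (hc : ∀ i j, c i j < 2) :
    ∃ x₁ y₁ x₂ y₂ : ℝ, 0 ≤ x₁ ∧ x₁ ≤ y₁ ∧ y₁ ≤ 1 ∧ 0 ≤ x₂ ∧ x₂ ≤ y₂ ∧ y₂ ≤ 1 ∧
      5 / 2 * (1 / (2 : ℝ) ^ (t + 5)) ≤ (y₁ - x₁) * (y₂ - x₂) ∧
      ∀ n : ℕ, n < 2 ^ (t + 5) → ¬ (x₁ < (n : ℝ) / 2 ^ (t + 5) ∧ (n : ℝ) / 2 ^ (t + 5) < y₁ ∧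
        x₂ < nltMap2 (t + 5) c n ∧ nltMap2 (t + 5) c n < y₂) := by
  obtain ⟨x, y, u, v, hxy, hy, huv, hv, harea, hE⟩ :=
    exists_box5 (c (t + 2) (t + 1)) (c (t + 3) (t + 1)) (c (t + 3) (t + 2))
        (c (t + 4) (t + 1)) (c (t + 4) (t + 2)) (c (t + 4) (t + 3))
        (c (t + 5) (t + 1)) (c (t + 5) (t + 2)) (c (t + 5) (t + 3)) (c (t + 5) (t + 4))
        (hc _ _) (hc _ _) (hc _ _) (hc _ _) (hc _ _) (hc _ _) (hc _ _) (hc _ _) (hc _ _) (hc _ _)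
  have hT : (0 : ℝ) < 2 ^ t := by positivity
  have hT1 : (1 : ℝ) ≤ 2 ^ t := one_le_pow₀ (by norm_num)
  have hxy' : (x : ℝ) ≤ y := by exact_mod_cast hxy
  have hy' : (y : ℝ) ≤ 32 := by exact_mod_cast hy
  have huv' : (u : ℝ) ≤ v := by exact_mod_cast huv
  have hv' : (v : ℝ) ≤ 32 := by exact_mod_cast hv
  have harea' : (80 : ℝ) + x * v + y * u ≤ y * v + x * u := by exact_mod_cast harea
  refine ⟨x / 32, y / 32, u / (32 * 2 ^ t), v / (32 * 2 ^ t), by positivity, by gcongr, ?_,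
    by positivity, by gcongr, ?_, ?_, ?_⟩
  · rw [div_le_one (by norm_num)]; exact hy'
  · rw [div_le_one (by positivity)]; nlinarith
  · have e1 : 5 / 2 * (1 / (2 : ℝ) ^ (t + 5)) = 80 / (1024 * 2 ^ t) := by
      rw [pow_add]; field_simp; norm_num
    have e2 : ((y : ℝ) / 32 - x / 32) * (v / (32 * 2 ^ t) - u / (32 * 2 ^ t))
        = ((y - x) * (v - u)) / (1024 * 2 ^ t) := by
      field_simp; ring
    rw [e1, e2]
    gcongr
    linarith
  · rintro n hn ⟨h1, h2, h3, h4⟩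
    have h5 : nltMap2 (t + 5) c n < 1 / (2 : ℝ) ^ t := by
      refine lt_of_lt_of_le h4 ?_
      rw [div_le_div_iff₀ (by positivity) hT]
      nlinarith
    obtain ⟨k, hk, rfl, hmu⟩ := strip t c n hn h5
    have e3 : (((2 ^ t * k : ℕ) : ℝ)) / 2 ^ (t + 5) = k / 32 := by
      push_cast; rw [pow_add]; field_simp; norm_num
    rw [e3] at h1 h2
    rw [hmu] at h3 h4
    rw [div_lt_div_iff_of_pos_right (by positivity)] at h1 h2 h3 h4
    exact hE k hk ⟨by exact_mod_cast h1, by exact_mod_cast h2, by exact_mod_cast h3,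
      by exact_mod_cast h4⟩

lemma disp_ge_of_open_box (P : Set (ℝ × ℝ)) (x₁ y₁ x₂ y₂ A : ℝ) (hx : 0 ≤ x₁) (hxy : x₁ ≤ y₁)
    (hy : y₁ ≤ 1) (hu : 0 ≤ x₂) (huv : x₂ ≤ y₂) (hv : y₂ ≤ 1) (hA : 0 < A)
    (hA' : A ≤ (y₁ - x₁) * (y₂ - x₂))
    (hE : ∀ p ∈ P, p ∉ Set.Ioo x₁ y₁ ×ˢ Set.Ioo x₂ y₂) : A ≤ disp P := by
  have hbdd : BddAbove (emptyBoxAreas P) := by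
    refine ⟨1, ?_⟩
    rintro a ⟨p, q, r, s, h1, h2, h3, h4, h5, h6, -, rfl⟩
    nlinarith
  have hx' : x₁ < y₁ := lt_of_le_of_ne hxy (by rintro rfl; simp at hA'; linarith)
  have hu' : x₂ < y₂ := lt_of_le_of_ne huv (by rintro rfl; simp at hA'; linarith)
  refine le_of_forall_pos_le_add fun ε hε => ?_
  obtain ⟨δ, hδ, hδε, hδ1, hδ2⟩ : ∃ δ : ℝ, 0 < δ ∧ 2 * δ ≤ ε ∧ δ ≤ y₁ - x₁ ∧ δ ≤ y₂ - x₂ := by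
    refine ⟨min (ε / 2) (min (y₁ - x₁) (y₂ - x₂)), ?_, ?_, ?_, ?_⟩
    · refine lt_min (by linarith) (lt_min ?_ ?_) <;> linarith
    · linarith [min_le_left (ε / 2) (min (y₁ - x₁) (y₂ - x₂))]
    · exact (min_le_right _ _).trans (min_le_left _ _)
    · exact (min_le_right _ _).trans (min_le_right _ _)
  have hmem : (y₁ - (x₁ + δ)) * (y₂ - (x₂ + δ)) ∈ emptyBoxAreas P := by
    refine ⟨x₁ + δ, y₁, x₂ + δ, y₂, by linarith, by linarith, hy, by linarith, by linarith, hv,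
      ?_, rfl⟩
    rintro p hp ⟨⟨h1, h2⟩, h3, h4⟩
    exact hE p hp ⟨⟨by linarith, h2⟩, by linarith, h4⟩
  have h7 := le_csSup hbdd hmem
  unfold disp
  nlinarith

/-- Lower bound for the dispersion of dyadic NLT nets with `m ≥ 5`:
`disp(P) ≥ (5/2)·(1/2^m)`; concretely there is an axis-parallel box of area at least
`(5/2)·(1/2^m)` in `[0,1]²` containing no point of `P`. -/
theorem disp_dyadic_NLT_ge (m : ℕ) (hm : 5 ≤ m) (c : ℕ → ℕ → ℕ)
    (hc : ∀ i j, c i j < 2)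
    (P : Set (ℝ × ℝ))
    (hP : P = {p : ℝ × ℝ | ∃ n : ℕ, n < 2 ^ m ∧ p = ((n : ℝ) / (2 : ℝ) ^ m, nltMap2 m c n)}) :
    disp P ≥ 5 / 2 * (1 / (2 : ℝ) ^ m) ∧
    ∃ x₁ y₁ x₂ y₂ : ℝ, 0 ≤ x₁ ∧ x₁ ≤ y₁ ∧ y₁ ≤ 1 ∧ 0 ≤ x₂ ∧ x₂ ≤ y₂ ∧ y₂ ≤ 1 ∧
      5 / 2 * (1 / (2 : ℝ) ^ m) ≤ (y₁ - x₁) * (y₂ - x₂) ∧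
      ∀ p ∈ P, p ∉ Set.Ioo x₁ y₁ ×ˢ Set.Ioo x₂ y₂ := by
  obtain ⟨t, rfl⟩ : ∃ t, m = t + 5 := ⟨m - 5, by omega⟩
  obtain ⟨x₁, y₁, x₂, y₂, h1, h2, h3, h4, h5, h6, h7, h8⟩ := exists_open_box t c hc
  have hE : ∀ p ∈ P, p ∉ Set.Ioo x₁ y₁ ×ˢ Set.Ioo x₂ y₂ := by
    rw [hP]
    rintro p ⟨n, hn, rfl⟩ ⟨⟨a1, a2⟩, a3, a4⟩
    exact h8 n hn ⟨a1, a2, a3, a4⟩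
  exact ⟨disp_ge_of_open_box P x₁ y₁ x₂ y₂ _ h1 h2 h3 h4 h5 h6 (by positivity) h7 hE,
    x₁, y₁, x₂, y₂, h1, h2, h3, h4, h5, h6, h7, hE⟩
end

section
/- For every integer m ≥ 4, the point set P̃_m^U = {(n/2^m, ψ(n)) : n = 0,1,…,2^m−1}, where ψ(n) = Σ_{i=1}^m ((e_{i−1} + e_i) mod 2)/2^i with e₀ := 0, satisfies disp(P̃_m^U) = (5/2)·(1/2^m); that is, every axis-parallel box in [0,1]² containing no point of P̃_m^U has area at most (5/2)·(1/2^m), and there exists such an empty box of this area. -/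
/-- The map `ψ(n) = Σ_{i=1}^m ((e_{i-1} + e_i) mod 2)/2^i` with the convention `e₀ = 0`. -/
noncomputable def psiMap (m n : ℕ) : ℝ :=
  ∑ i ∈ Finset.Icc 1 m,
    (((nthDigit 2 n (i - 1) + nthDigit 2 n i) % 2 : ℕ) : ℝ) / (2 : ℝ) ^ i


/-- Integer version of `2^m * psiMap m n`, defined recursively from the lowest digit. -/
def gpsi : ℕ → ℕ → ℕ
  | 0, _ => 0
  | m + 1, n => if n % 2 = 0 then gpsi m (n / 2) else 2 ^ m + gpsi m (2 ^ m - 1 - n / 2)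

theorem gpsi_even (m n : ℕ) : gpsi (m + 1) (2 * n) = gpsi m n := by
  simp [gpsi]

theorem gpsi_odd (m n : ℕ) :
    gpsi (m + 1) (2 * n + 1) = 2 ^ m + gpsi m (2 ^ m - 1 - n) := by
  have h1 : (2 * n + 1) % 2 = 1 := by omega
  have h2 : (2 * n + 1) / 2 = n := by omega
  simp [gpsi, h1, h2]

theorem gpsi_lt (m n : ℕ) : gpsi m n < 2 ^ m := by
  induction m generalizing n with
  | zero => simp [gpsi]
  | succ m ih =>
    have := ih (n / 2)
    have := ih (2 ^ m - 1 - n / 2)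
    rw [gpsi, pow_succ]
    split_ifs <;> omega

/-- Multiplication of the argument by `2^p` drops leading zero digits. -/
theorem gpsi_shift (k p n : ℕ) : gpsi (k + p) (2 ^ p * n) = gpsi k n := by
  induction p with
  | zero => simp
  | succ p ih =>
    rw [← add_assoc, pow_succ, mul_comm (2 ^ p) 2, mul_assoc, gpsi_even, ih]

/-- The alternating digit pattern `1,0,1,0,…` of length `p` (lowest digit first). -/
def altB : ℕ → ℕ
  | 0 => 0
  | p + 1 => 2 ^ (p + 1) - 1 - 2 * altB p

theorem altB_spec (p : ℕ) :
    (p % 2 = 0 → 3 * altB p + 1 = 2 ^ p) ∧ (p % 2 = 1 → 3 * altB p + 1 = 2 * 2 ^ p) := by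
  induction p with
  | zero => simp [altB]
  | succ p ih =>
    have := Nat.one_le_two_pow (n := p)
    simp only [altB, pow_succ]
    constructor <;> intro h <;> rcases Nat.mod_two_eq_zero_or_one p with hpar | hpar <;>
      simp only [hpar, forall_true_left] at ih <;> omega

theorem gpsi_altB (k p w : ℕ) (hw : w < 2 ^ k) :
    gpsi (k + p) (altB p + 2 ^ p * w) + 2 ^ k =
      2 ^ (k + p) + gpsi k (if p % 2 = 0 then w else 2 ^ k - 1 - w) := by
  induction p generalizing w with
  | zero => simp [altB, add_comm]
  | succ p ih =>
    have hw' : 2 ^ k - 1 - w < 2 ^ k := by omega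
    have hs := altB_spec p
    have h1 := Nat.one_le_two_pow (n := p)
    have hlt : altB p < 2 ^ p := by
      rcases Nat.mod_two_eq_zero_or_one p with hpar | hpar <;> simp only [hpar, forall_true_left] at hs <;> omega
    have e1 : altB (p + 1) + 2 ^ (p + 1) * w = 2 * (2 ^ p - 1 - altB p + 2 ^ p * w) + 1 := by
      simp only [altB, pow_succ]
      have : 2 ^ p * 2 * w = 2 * (2 ^ p * w) := by ring
      omega
    have e2 : 2 ^ (k + p) - 1 - (2 ^ p - 1 - altB p + 2 ^ p * w)
        = altB p + 2 ^ p * (2 ^ k - 1 - w) := by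
      obtain ⟨v, hv⟩ : ∃ v, 2 ^ k = w + v + 1 := ⟨2 ^ k - 1 - w, by omega⟩
      have : 2 ^ (k + p) = 2 ^ p * w + 2 ^ p * v + 2 ^ p := by rw [pow_add, hv]; ring
      have h3 : 2 ^ k - 1 - w = v := by omega
      rw [h3]
      omega
    rw [e1, ← add_assoc, gpsi_odd, e2, add_assoc, ih _ hw', pow_succ]
    have h4 : 2 ^ k - 1 - (2 ^ k - 1 - w) = w := by omega
    rw [h4]
    rcases Nat.mod_two_eq_zero_or_one p with hpar | hpar
    · have : (p + 1) % 2 = 1 := by omega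
      simp [hpar, this]; ring
    · have : (p + 1) % 2 = 0 := by omega
      simp [hpar, this]; ring

/-- The values of `gpsi` on a block of four consecutive arguments, and on the complements. -/
theorem gpsi_block (k t : ℕ) (ht : t < 2 ^ k) : ∃ c c' : ℕ, c < 2 ^ k ∧ c' < 2 ^ k ∧
    gpsi (k + 2) (4 * t) = c ∧ gpsi (k + 2) (4 * t + 1) = c + 3 * 2 ^ k ∧
    gpsi (k + 2) (4 * t + 2) = c' + 2 ^ k ∧ gpsi (k + 2) (4 * t + 3) = c' + 2 * 2 ^ k ∧
    gpsi (k + 2) (4 * 2 ^ k - 1 - 4 * t) = c + 2 * 2 ^ k ∧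
    gpsi (k + 2) (4 * 2 ^ k - 1 - (4 * t + 1)) = c + 2 ^ k ∧
    gpsi (k + 2) (4 * 2 ^ k - 1 - (4 * t + 2)) = c' + 3 * 2 ^ k ∧
    gpsi (k + 2) (4 * 2 ^ k - 1 - (4 * t + 3)) = c' := by
  have key : ∀ t, t < 2 ^ k →
      gpsi (k + 2) (4 * t) = gpsi k t ∧ gpsi (k + 2) (4 * t + 1) = gpsi k t + 3 * 2 ^ k ∧
      gpsi (k + 2) (4 * t + 2) = gpsi k (2 ^ k - 1 - t) + 2 ^ k ∧
      gpsi (k + 2) (4 * t + 3) = gpsi k (2 ^ k - 1 - t) + 2 * 2 ^ k := by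
    intro t ht
    have a0 : 4 * t = 2 * (2 * t) := by ring
    have a1 : 4 * t + 1 = 2 * (2 * t) + 1 := by ring
    have a2 : 4 * t + 2 = 2 * (2 * t + 1) := by ring
    have a3 : 4 * t + 3 = 2 * (2 * t + 1) + 1 := by ring
    have b1 : 2 ^ (k + 1) - 1 - 2 * t = 2 * (2 ^ k - 1 - t) + 1 := by rw [pow_succ]; omega
    have b3 : 2 ^ (k + 1) - 1 - (2 * t + 1) = 2 * (2 ^ k - 1 - t) := by rw [pow_succ]; omega
    have b4 : 2 ^ k - 1 - (2 ^ k - 1 - t) = t := by omega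
    refine ⟨?_, ?_, ?_, ?_⟩
    · rw [a0, gpsi_even, gpsi_even]
    · rw [a1, gpsi_odd, b1, gpsi_odd, b4, pow_succ]; ring
    · rw [a2, gpsi_even, gpsi_odd]; ring
    · rw [a3, gpsi_odd, b3, gpsi_even, pow_succ]; ring
  obtain ⟨h0, h1, h2, h3⟩ := key t ht
  obtain ⟨g0, g1, g2, g3⟩ := key (2 ^ k - 1 - t) (by omega)
  have b4 : 2 ^ k - 1 - (2 ^ k - 1 - t) = t := by omega
  rw [b4] at g2 g3
  refine ⟨gpsi k t, gpsi k (2 ^ k - 1 - t), gpsi_lt _ _, gpsi_lt _ _, h0, h1, h2, h3, ?_, ?_, ?_, ?_⟩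
  · rw [← g3]; congr 1; omega
  · rw [← g2]; congr 1; omega
  · rw [← g1]; congr 1; omega
  · rw [← g0]; congr 1; omega

/-- The depth of a column above the middle line. -/
theorem gpsi_upper (k p w : ℕ) (hw : w < 2 ^ k) :
    gpsi (k + p + 1) (2 * 2 ^ p * (w + 1) - 1) = 2 ^ (k + p) + gpsi k (2 ^ k - 1 - w) := by
  obtain ⟨v, hv⟩ : ∃ v, 2 ^ k = w + v + 1 := ⟨2 ^ k - 1 - w, by omega⟩
  have h1 := Nat.one_le_two_pow (n := p)
  have e1 : 2 * 2 ^ p * (w + 1) - 1 = 2 * (2 ^ p * w + 2 ^ p - 1) + 1 := by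
    have : 2 * 2 ^ p * (w + 1) = 2 * (2 ^ p * w) + 2 * 2 ^ p := by ring
    omega
  have e2 : 2 ^ (k + p) - 1 - (2 ^ p * w + 2 ^ p - 1) = 2 ^ p * (2 ^ k - 1 - w) := by
    have : 2 ^ (k + p) = 2 ^ p * w + 2 ^ p * v + 2 ^ p := by rw [pow_add, hv]; ring
    have h3 : 2 ^ k - 1 - w = v := by omega
    rw [h3]
    omega
  rw [e1, gpsi_odd, e2, gpsi_shift]

/-- The depth of a column below the middle line. -/
theorem gpsi_lower (k p w : ℕ) (hw : w < 2 ^ k) :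
    gpsi (k + p + 1) (2 * altB p + 2 * 2 ^ p * w) + 2 ^ k =
      2 ^ (k + p) + gpsi k (if p % 2 = 0 then w else 2 ^ k - 1 - w) := by
  have e1 : 2 * altB p + 2 * 2 ^ p * w = 2 * (altB p + 2 ^ p * w) := by ring
  rw [e1, gpsi_even, gpsi_altB _ _ _ hw]

theorem psiMap_range (m n : ℕ) : psiMap m n = ∑ j ∈ Finset.range m,
    (((nthDigit 2 n j + nthDigit 2 n (j + 1)) % 2 : ℕ) : ℝ) / (2 : ℝ) ^ (j + 1) := by
  unfold psiMap
  induction m with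
  | zero => simp
  | succ m ih => rw [Finset.sum_Icc_succ_top (by omega), ih, Finset.sum_range_succ]; rfl

theorem nthDigit_even (n j : ℕ) (h : n % 2 = 0) : nthDigit 2 n (j + 1) = nthDigit 2 (n / 2) j := by
  unfold nthDigit
  rcases j with _ | j
  · simp [h]
  · simp [pow_succ', Nat.div_div_eq_div_mul]

theorem nthDigit_odd (m n j : ℕ) (h : n % 2 = 1) (hn : n < 2 ^ (m + 1)) (hj : j ≤ m) :
    nthDigit 2 n (j + 1) = 1 - nthDigit 2 (2 ^ m - 1 - n / 2) j := by
  unfold nthDigit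
  rcases j with _ | j
  · simp [h]
  · have h2 : n / 2 < 2 ^ m := by rw [pow_succ] at hn; omega
    have := Nat.testBit_two_pow_sub_succ h2 j
    have e : 2 ^ m - (n / 2 + 1) = 2 ^ m - 1 - n / 2 := by omega
    rw [e] at this
    simp only [Nat.add_eq_zero_iff, one_ne_zero, and_false, if_false, Nat.add_sub_cancel]
    rw [← Nat.toNat_testBit, ← Nat.toNat_testBit, this]
    have e3 : n.testBit (j + 1) = (n / 2).testBit j := by rw [Nat.testBit_succ]
    rw [e3]
    have : j < m := hj
    cases (n / 2).testBit j <;> simp [this]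

theorem nthDigit_le (n j : ℕ) : nthDigit 2 n j ≤ 1 := by
  unfold nthDigit
  split_ifs <;> omega

theorem psiMap_eq (m n : ℕ) (hn : n < 2 ^ m) : psiMap m n = (gpsi m n : ℝ) / 2 ^ m := by
  induction m generalizing n with
  | zero => simp [psiMap, gpsi]
  | succ m ih =>
    rw [psiMap_range, Finset.sum_range_succ']
    have h2 : n / 2 < 2 ^ m := by rw [pow_succ] at hn; omega
    rcases Nat.mod_two_eq_zero_or_one n with h | h
    · have ih' := ih (n / 2) h2
      rw [psiMap_range] at ih'
      have e : ∑ j ∈ Finset.range m, (((nthDigit 2 n (j + 1) + nthDigit 2 n (j + 1 + 1)) % 2 : ℕ) : ℝ)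
          / (2 : ℝ) ^ (j + 1 + 1) = (∑ j ∈ Finset.range m,
          (((nthDigit 2 (n / 2) j + nthDigit 2 (n / 2) (j + 1)) % 2 : ℕ) : ℝ) / (2 : ℝ) ^ (j + 1)) / 2 := by
        rw [Finset.sum_div]
        refine Finset.sum_congr rfl fun j _ => ?_
        rw [nthDigit_even n j h, nthDigit_even n (j + 1) h, pow_succ _ (j + 1), div_div]
      rw [e, ih']
      simp [nthDigit, gpsi, h, pow_succ, div_div]
    · have ih' := ih (2 ^ m - 1 - n / 2) (by omega)
      rw [psiMap_range] at ih'
      have e : ∑ j ∈ Finset.range m, (((nthDigit 2 n (j + 1) + nthDigit 2 n (j + 1 + 1)) % 2 : ℕ) : ℝ)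
          / (2 : ℝ) ^ (j + 1 + 1) = (∑ j ∈ Finset.range m,
          (((nthDigit 2 (2 ^ m - 1 - n / 2) j + nthDigit 2 (2 ^ m - 1 - n / 2) (j + 1)) % 2 : ℕ) : ℝ)
            / (2 : ℝ) ^ (j + 1)) / 2 := by
        rw [Finset.sum_div]
        refine Finset.sum_congr rfl fun j hj => ?_
        have hj' := Finset.mem_range.1 hj
        rw [nthDigit_odd m n j h hn (by omega), nthDigit_odd m n (j + 1) h hn (by omega),
          pow_succ _ (j + 1), div_div]
        have d1 := nthDigit_le (2 ^ m - 1 - n / 2) j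
        have d2 := nthDigit_le (2 ^ m - 1 - n / 2) (j + 1)
        congr 2
        omega
      rw [e, ih']
      simp [nthDigit, gpsi, h, pow_succ]
      field_simp
      ring

/-- Combining a bound on the width with a bound on the height. -/
theorem prod_bound (Q R l h : ℕ)
    (H : (l ≤ 2 * Q ∧ h ≤ 5 * R) ∨ (3 * l ≤ 5 * Q ∧ h ≤ 6 * R) ∨ (7 * l ≤ 10 * Q ∧ h ≤ 7 * R)) :
    2 * (l * h) ≤ 5 * (Q * (4 * R)) := by
  rcases H with ⟨h1, h2⟩ | ⟨h1, h2⟩ | ⟨h1, h2⟩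
  all_goals
    have := Nat.mul_le_mul h1 h2
    nlinarith

set_option maxHeartbeats 4000000 in
/-- The combinatorial core: a box crossing the middle line, at resolution `M = 4 R`. -/
theorem core_four (Q A R s L a b : ℕ) (F G H : ℕ → ℕ) (hQ : 2 ≤ Q)
    (hblock : ∀ t < R, ∃ c c' : ℕ, c < R ∧ c' < R ∧
      F (4 * t) = c ∧ F (4 * t + 1) = c + 3 * R ∧
      F (4 * t + 2) = c' + R ∧ F (4 * t + 3) = c' + 2 * R ∧
      G (4 * t) = c + 2 * R ∧ G (4 * t + 1) = c + R ∧
      G (4 * t + 2) = c' + 3 * R ∧ G (4 * t + 3) = c')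
    (hA : (H = F ∧ 3 * A + 2 = Q) ∨ (H = G ∧ 3 * A + 2 = 2 * Q))
    (hQL : Q ≤ L) (hL2 : L < 2 * Q) (hsL : s + L ≤ Q * (4 * R))
    (hU : ∀ w < 4 * R, s + 1 ≤ Q * w + Q → Q * w + Q ≤ s + L → b ≤ G w)
    (hLo : ∀ w < 4 * R, s ≤ A + Q * w → A + Q * w < s + L → a + H w + 1 ≤ 4 * R) :
    2 * ((L + 1) * (a + b + 1)) ≤ 5 * (Q * (4 * R)) := by
  apply prod_bound
  obtain ⟨w, r, hs, hr⟩ : ∃ w r, s = Q * w + r ∧ r < Q :=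
    ⟨s / Q, s % Q, (Nat.div_add_mod s Q).symm, Nat.mod_lt _ (by omega)⟩
  have hlt : ∀ v, Q * v < Q * (4 * R) → v < 4 * R := fun v hv => Nat.lt_of_mul_lt_mul_left hv
  have u0 : ∀ v, v = w → v < 4 * R ∧ b ≤ G v := by
    rintro v rfl
    have := hlt v (by omega)
    exact ⟨this, hU v this (by omega) (by omega)⟩
  have u1 : ∀ v, v = w + 1 → Q * w + 2 * Q ≤ s + L → v < 4 * R ∧ b ≤ G v := by
    rintro v rfl h
    have e : Q * (w + 1) = Q * w + Q := by ring
    have := hlt (w + 1) (by omega)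
    exact ⟨this, hU _ this (by omega) (by omega)⟩
  have l0 : ∀ v, v = w → r ≤ A → v < 4 * R ∧ a + H v + 1 ≤ 4 * R := by
    rintro v rfl h
    have := hlt v (by omega)
    exact ⟨this, hLo _ this (by omega) (by omega)⟩
  have l1 : ∀ v, v = w + 1 → A + Q < r + L → v < 4 * R ∧ a + H v + 1 ≤ 4 * R := by
    rintro v rfl h
    have e : Q * (w + 1) = Q * w + Q := by ring
    have := hlt (w + 1) (by omega)
    exact ⟨this, hLo _ this (by omega) (by omega)⟩
  have l2 : ∀ v, v = w + 2 → A + 2 * Q < r + L → v < 4 * R ∧ a + H v + 1 ≤ 4 * R := by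
    rintro v rfl h
    have e : Q * (w + 2) = Q * w + 2 * Q := by ring
    have := hlt (w + 2) (by omega)
    exact ⟨this, hLo _ this (by omega) (by omega)⟩
  obtain ⟨t, i, hw, hi⟩ : ∃ t i, w = 4 * t + i ∧ i < 4 := ⟨w / 4, w % 4, by omega, by omega⟩
  have hwM := (u0 w rfl).1
  have hb' : t + 1 < R → _ := hblock (t + 1)
  obtain ⟨c, c', hc, hc', f0, f1, f2, f3, g0, g1, g2, g3⟩ := hblock t (by omega)
  have hnext : t + 1 < R → F (4 * (t + 1)) < R ∧ F (4 * (t + 1) + 1) ≥ 3 * R ∧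
      G (4 * (t + 1)) < 3 * R ∧ 2 * R ≤ G (4 * (t + 1)) ∧
      R ≤ G (4 * (t + 1) + 1) ∧ G (4 * (t + 1) + 1) < 2 * R := by
    intro h
    obtain ⟨d, d', hd, hd', f0, f1, f2, f3, g0, g1, g2, g3⟩ := hblock (t + 1) h
    omega
  clear hblock hb' hU hLo hlt
  interval_cases i
  · have v0 := u0 (4 * t) (by omega)
    have v1 := u1 (4 * t + 1) (by omega)
    have m0 := l0 (4 * t) (by omega)
    have m1 := l1 (4 * t + 1) (by omega)
    have m2 := l2 (4 * t + 2) (by omega)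
    clear u0 u1 l0 l1 l2
    by_cases k1 : Q * w + 2 * Q ≤ s + L <;> by_cases k2 : r ≤ A <;>
      by_cases k3 : A + Q < r + L <;> by_cases k4 : A + 2 * Q < r + L <;>
      simp only [k1, k2, k3, k4, forall_true_left, false_imp_iff] at v1 m0 m1 m2 <;>
      rcases hA with ⟨rfl, hA⟩ | ⟨rfl, hA⟩ <;> omega
  · have v0 := u0 (4 * t + 1) (by omega)
    have v1 := u1 (4 * t + 2) (by omega)
    have m0 := l0 (4 * t + 1) (by omega)
    have m1 := l1 (4 * t + 2) (by omega)
    have m2 := l2 (4 * t + 3) (by omega)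
    clear u0 u1 l0 l1 l2
    by_cases k1 : Q * w + 2 * Q ≤ s + L <;> by_cases k2 : r ≤ A <;>
      by_cases k3 : A + Q < r + L <;> by_cases k4 : A + 2 * Q < r + L <;>
      simp only [k1, k2, k3, k4, forall_true_left, false_imp_iff] at v1 m0 m1 m2 <;>
      rcases hA with ⟨rfl, hA⟩ | ⟨rfl, hA⟩ <;> omega
  · have v0 := u0 (4 * t + 2) (by omega)
    have v1 := u1 (4 * t + 3) (by omega)
    have m0 := l0 (4 * t + 2) (by omega)
    have m1 := l1 (4 * t + 3) (by omega)
    have m2 := l2 (4 * (t + 1)) (by omega)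
    clear u0 u1 l0 l1 l2
    by_cases k1 : Q * w + 2 * Q ≤ s + L <;> by_cases k2 : r ≤ A <;>
      by_cases k3 : A + Q < r + L <;> by_cases k4 : A + 2 * Q < r + L <;>
      simp only [k1, k2, k3, k4, forall_true_left, false_imp_iff] at v1 m0 m1 m2 <;>
      rcases hA with ⟨rfl, hA⟩ | ⟨rfl, hA⟩ <;> omega
  · have v0 := u0 (4 * t + 3) (by omega)
    have v1 := u1 (4 * (t + 1)) (by omega)
    have m0 := l0 (4 * t + 3) (by omega)
    have m1 := l1 (4 * (t + 1)) (by omega)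
    have m2 := l2 (4 * (t + 1) + 1) (by omega)
    clear u0 u1 l0 l1 l2
    by_cases k1 : Q * w + 2 * Q ≤ s + L <;> by_cases k2 : r ≤ A <;>
      by_cases k3 : A + Q < r + L <;> by_cases k4 : A + 2 * Q < r + L <;>
      simp only [k1, k2, k3, k4, forall_true_left, false_imp_iff] at v1 m0 m1 m2 <;>
      rcases hA with ⟨rfl, hA⟩ | ⟨rfl, hA⟩ <;> omega

/-- The bound for a box crossing the middle line. -/
theorem core_cross (k p s L a b : ℕ)
    (hQL : 2 * 2 ^ p ≤ L) (hL2 : L < 2 * (2 * 2 ^ p)) (hsL : s + L ≤ 2 * 2 ^ p * 2 ^ k)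
    (hU : ∀ w < 2 ^ k, s + 1 ≤ 2 * 2 ^ p * w + 2 * 2 ^ p →
      2 * 2 ^ p * w + 2 * 2 ^ p ≤ s + L → b ≤ gpsi k (2 ^ k - 1 - w))
    (hLo : ∀ w < 2 ^ k, s ≤ 2 * altB p + 2 * 2 ^ p * w → 2 * altB p + 2 * 2 ^ p * w < s + L →
      a + gpsi k (if p % 2 = 0 then w else 2 ^ k - 1 - w) + 1 ≤ 2 ^ k) :
    2 * ((L + 1) * (a + b + 1)) ≤ 5 * (2 * 2 ^ p * 2 ^ k) := by
  have hspec := altB_spec p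
  have h1 := Nat.one_le_two_pow (n := p)
  generalize hQ : 2 ^ p = q at *
  generalize hAd : altB p = A at *
  rcases k with _ | _ | k
  · have u := hU 0 (by simp) (by omega) (by omega)
    have l := hLo 0 (by simp) (by simp at hsL; omega) (by
      rcases Nat.mod_two_eq_zero_or_one p with hpar | hpar <;> simp only [hpar, forall_true_left] at hspec <;> omega)
    simp only [gpsi, pow_zero] at u l
    have ha : a = 0 := by omega
    have hb : b = 0 := by omega
    subst ha hb
    simp at hsL ⊢
    omega
  · have u0 := hU 0 (by simp)
    have u1 := hU 1 (by simp)
    have l0 := hLo 0 (by simp)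
    have l1 := hLo 1 (by simp)
    have key : (a + b + 1 ≤ 2 ∧ L + 1 ≤ 4 * q) ∨ (a + b + 1 ≤ 3 ∧ 3 * (L + 1) ≤ 10 * q) := by
      rcases Nat.mod_two_eq_zero_or_one p with hpar | hpar <;>
        simp [hpar, gpsi] at hspec u0 u1 l0 l1 hsL <;> omega
    rcases key with ⟨h2, h3⟩ | ⟨h2, h3⟩
    · have := Nat.mul_le_mul h2 h3
      simp only [zero_add, pow_one]
      nlinarith
    · have := Nat.mul_le_mul h2 h3
      simp only [zero_add, pow_one]
      nlinarith
  · have e : 2 ^ (k + 2) = 4 * 2 ^ k := by ring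
    simp only [add_assoc, Nat.reduceAdd] at *
    simp only [e] at hsL hU hLo ⊢
    refine core_four (2 * q) (2 * A) (2 ^ k) s L a b (fun w => gpsi (k + 2) w)
      (fun w => gpsi (k + 2) (4 * 2 ^ k - 1 - w))
      (fun w => gpsi (k + 2) (if p % 2 = 0 then w else 4 * 2 ^ k - 1 - w)) (by omega)
      (fun t ht => gpsi_block k t ht) ?_ hQL hL2 hsL hU hLo
    rcases Nat.mod_two_eq_zero_or_one p with hpar | hpar <;>
      simp only [hpar, forall_true_left] at hspec
    · left
      exact ⟨by simp [hpar], by omega⟩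
    · right
      exact ⟨by simp [hpar], by omega⟩

/-- Integer form of the upper bound. -/
theorem box_bound (m s L c H : ℕ) (hs : s + L ≤ 2 ^ m) (hc : c + H ≤ 2 ^ m)
    (hE : ∀ x, s ≤ x → x < s + L → c ≤ gpsi m x → gpsi m x < c + H → False) :
    2 * ((L + 1) * (H + 1)) ≤ 5 * 2 ^ m := by
  induction m generalizing s L c H with
  | zero =>
    have h0 : gpsi 0 0 = 0 := rfl
    simp only [pow_zero] at hs hc ⊢
    have : L = 0 ∨ H = 0 := by
      by_contra hcon
      exact hE 0 (by omega) (by omega) (by omega) (by omega)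
    rcases this with rfl | rfl <;> omega
  | succ m ih =>
    have hN := Nat.one_le_two_pow (n := m)
    have eN : 2 ^ (m + 1) = 2 * 2 ^ m := by ring
    rcases le_or_gt (c + H) (2 ^ m) with hlow | hlow
    · have := ih ((s + 1) / 2) ((s + L + 1) / 2 - (s + 1) / 2) c H (by omega) hlow (by
        intro x h1 h2 h3 h4
        apply hE (2 * x) (by omega) (by omega) <;> rw [gpsi_even] <;> assumption)
      have h5 : L + 1 ≤ 2 * ((s + L + 1) / 2 - (s + 1) / 2 + 1) := by omega
      have h6 := Nat.mul_le_mul_right (H + 1) h5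
      rw [eN]
      nlinarith
    rcases le_or_gt (2 ^ m) c with hup | hup
    · have := ih (2 ^ m - (s + L) / 2) ((s + L) / 2 - s / 2) (c - 2 ^ m) H (by omega) (by omega) (by
        intro x h1 h2 h3 h4
        have e : 2 ^ m - 1 - (2 ^ m - 1 - x) = x := by omega
        apply hE (2 * (2 ^ m - 1 - x) + 1) (by omega) (by omega) <;> rw [gpsi_odd, e] <;> omega)
      have h5 : L + 1 ≤ 2 * ((s + L) / 2 - s / 2 + 1) := by omega
      have h6 := Nat.mul_le_mul_right (H + 1) h5
      rw [eN]
      nlinarith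
    · clear ih
      rcases Nat.lt_or_ge L 2 with hL | hL
      · rcases Nat.lt_or_ge L 1 with hL0 | hL0
        · have : L = 0 := by omega
          subst this
          omega
        · have : L = 1 := by omega
          subst this
          have h2 := gpsi_lt (m + 1) s
          have h1 : H < 2 ^ (m + 1) := by
            by_contra hcon
            exact hE s le_rfl (by omega) (by omega) (by omega)
          omega
      · obtain ⟨p, hp1, hp2⟩ : ∃ p, 2 * 2 ^ p ≤ L ∧ L < 2 * (2 * 2 ^ p) := by
          have h1 : Nat.log 2 L ≠ 0 := by
            have := (Nat.log_pos (b := 2) (by norm_num) hL)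
            omega
          obtain ⟨p, hp⟩ := Nat.exists_eq_succ_of_ne_zero h1
          have h2 := Nat.pow_log_le_self 2 (x := L) (by omega)
          have h3 := Nat.lt_pow_succ_log_self (b := 2) (by norm_num) L
          rw [hp] at h2 h3
          refine ⟨p, ?_, ?_⟩
          · rw [Nat.succ_eq_add_one, pow_succ] at h2; omega
          · rw [Nat.succ_eq_add_one, pow_succ, pow_succ] at h3; omega
        have hpm : p ≤ m := by
          have : 2 ^ p ≤ 2 ^ m := by omega
          exact (Nat.pow_le_pow_iff_right (by norm_num)).1 this
        obtain ⟨k, rfl⟩ : ∃ k, m = k + p := ⟨m - p, by omega⟩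
        have eM : 2 * 2 ^ (k + p) = 2 * 2 ^ p * 2 ^ k := by ring
        have hH : H + 1 = (2 ^ (k + p) - c) + (c + H - 2 ^ (k + p)) + 1 := by omega
        rw [eN, eM, hH]
        refine core_cross k p s L _ _ hp1 hp2 (by omega) ?_ ?_
        · intro w hw h1 h2
          by_contra hcon
          have h3 := gpsi_upper k p w hw
          have e : 2 * 2 ^ p * (w + 1) = 2 * 2 ^ p * w + 2 * 2 ^ p := by ring
          rw [e] at h3
          exact hE _ (by omega) (by omega) (by omega : c ≤ gpsi (k + p + 1) (2 * 2 ^ p * w + 2 * 2 ^ p - 1)) (by omega)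
        · intro w hw h1 h2
          by_contra hcon
          have h3 := gpsi_lower k p w hw
          have h4 := gpsi_lt k (if p % 2 = 0 then w else 2 ^ k - 1 - w)
          exact hE _ h1 h2 (by omega) (by omega)

/-- Integer form of the lower bound. -/
theorem box_exists (j n : ℕ) (h1 : 3 * 2 ^ j < n) (h2 : n < 7 * 2 ^ j)
    (h3 : 2 < gpsi (j + 3) n) (h4 : gpsi (j + 3) n < 7) : False := by
  induction j generalizing n with
  | zero =>
    simp at h1 h2
    have : n = 4 ∨ n = 5 ∨ n = 6 := by omega
    rcases this with rfl | rfl | rfl <;> revert h3 h4 <;> decide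
  | succ j ih =>
    rw [pow_succ] at h1 h2
    have e : j + 1 + 3 = (j + 3) + 1 := by ring
    rw [e] at h3 h4
    rcases Nat.even_or_odd' n with ⟨x, rfl | rfl⟩
    · rw [gpsi_even] at h3 h4
      exact ih x (by omega) (by omega) h3 h4
    · rw [gpsi_odd, pow_add] at h4
      have := Nat.one_le_two_pow (n := j)
      omega

/-- The exact dispersion of the net `P̃_m^U = {(n/2^m, ψ(n))}` for `m ≥ 4`:
`disp(P̃_m^U) = (5/2)·(1/2^m)`; every axis-parallel empty box has area at most this
value, and there is an empty box of this area. -/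
theorem disp_PU (m : ℕ) (hm : 4 ≤ m) (P : Set (ℝ × ℝ))
    (hP : P = {p : ℝ × ℝ | ∃ n : ℕ, n < 2 ^ m ∧ p = ((n : ℝ) / (2 : ℝ) ^ m, psiMap m n)}) :
    disp P = 5 / 2 * (1 / (2 : ℝ) ^ m) ∧
    (∀ x₁ y₁ x₂ y₂ : ℝ, 0 ≤ x₁ → x₁ ≤ y₁ → y₁ ≤ 1 → 0 ≤ x₂ → x₂ ≤ y₂ → y₂ ≤ 1 →
      (∀ p ∈ P, p ∉ Set.Ico x₁ y₁ ×ˢ Set.Ico x₂ y₂) →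
      (y₁ - x₁) * (y₂ - x₂) ≤ 5 / 2 * (1 / (2 : ℝ) ^ m)) ∧
    ∃ x₁ y₁ x₂ y₂ : ℝ, 0 ≤ x₁ ∧ x₁ ≤ y₁ ∧ y₁ ≤ 1 ∧ 0 ≤ x₂ ∧ x₂ ≤ y₂ ∧ y₂ ≤ 1 ∧
      (y₁ - x₁) * (y₂ - x₂) = 5 / 2 * (1 / (2 : ℝ) ^ m) ∧
      ∀ p ∈ P, p ∉ Set.Ioo x₁ y₁ ×ˢ Set.Ioo x₂ y₂ := by
  have hN : (0 : ℝ) < 2 ^ m := by positivity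
  have hup : ∀ x₁ y₁ x₂ y₂ : ℝ, 0 ≤ x₁ → x₁ ≤ y₁ → y₁ ≤ 1 → 0 ≤ x₂ → x₂ ≤ y₂ → y₂ ≤ 1 →
      (∀ p ∈ P, p ∉ Set.Ico x₁ y₁ ×ˢ Set.Ico x₂ y₂) →
      (y₁ - x₁) * (y₂ - x₂) ≤ 5 / 2 * (1 / (2 : ℝ) ^ m) := by
    intro x₁ y₁ x₂ y₂ hx0 hx hx1 hy0 hy hy1 hE
    -- rounding of an interval to integers
    have round : ∀ u v : ℝ, 0 ≤ u → u ≤ v → v ≤ 1 → ∃ s L : ℕ, s + L ≤ 2 ^ m ∧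
        (v - u) * 2 ^ m ≤ L + 1 ∧
        ∀ n : ℕ, s ≤ n → n < s + L → u ≤ (n : ℝ) / 2 ^ m ∧ (n : ℝ) / 2 ^ m < v := by
      intro u v hu huv hv
      have hmono : ⌈u * 2 ^ m⌉₊ ≤ ⌈v * 2 ^ m⌉₊ := Nat.ceil_mono (by gcongr)
      obtain ⟨L, hL⟩ := Nat.exists_eq_add_of_le hmono
      refine ⟨⌈u * 2 ^ m⌉₊, L, ?_, ?_, ?_⟩
      · rw [← hL]
        apply Nat.ceil_le.2
        push_cast
        nlinarith
      · have h1 := Nat.ceil_lt_add_one (a := u * 2 ^ m) (by positivity)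
        have h2 := Nat.le_ceil (v * 2 ^ m)
        rw [hL] at h2
        push_cast at h2
        linarith
      · intro n h1 h2
        rw [← hL] at h2
        have h3 := Nat.ceil_le.1 h1
        have h4 := Nat.lt_ceil.1 h2
        exact ⟨(le_div_iff₀ hN).2 h3, (div_lt_iff₀ hN).2 h4⟩
    obtain ⟨s, L, hs, hLw, hI⟩ := round x₁ y₁ hx0 hx hx1
    obtain ⟨c, H, hc, hHw, hJ⟩ := round x₂ y₂ hy0 hy hy1
    have hb := box_bound m s L c H hs hc (by
      intro x h1 h2 h3 h4
      have hx2 : x < 2 ^ m := by omega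
      apply hE ((x : ℝ) / 2 ^ m, psiMap m x)
      · rw [hP]; exact ⟨x, hx2, rfl⟩
      · rw [psiMap_eq m x hx2]
        exact ⟨hI x h1 h2, hJ _ h3 h4⟩)
    have hb' : 2 * (((L : ℝ) + 1) * (H + 1)) ≤ 5 * 2 ^ m := by exact_mod_cast hb
    have h7 : ((y₁ - x₁) * 2 ^ m) * ((y₂ - x₂) * 2 ^ m) ≤ ((L : ℝ) + 1) * (H + 1) := by
      apply mul_le_mul hLw hHw
      · have : 0 ≤ y₂ - x₂ := by linarith
        positivity
      · positivity
    have e : 5 / 2 * (1 / (2 : ℝ) ^ m) = (5 / 2 * 2 ^ m) / (2 ^ m * 2 ^ m) := by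
      field_simp
    rw [e, le_div_iff₀ (by positivity)]
    nlinarith
  have hex : ∃ x₁ y₁ x₂ y₂ : ℝ, 0 ≤ x₁ ∧ x₁ < y₁ ∧ y₁ ≤ 1 ∧ 0 ≤ x₂ ∧ x₂ < y₂ ∧ y₂ ≤ 1 ∧
      (y₁ - x₁) * (y₂ - x₂) = 5 / 2 * (1 / (2 : ℝ) ^ m) ∧
      ∀ p ∈ P, p ∉ Set.Ioo x₁ y₁ ×ˢ Set.Ioo x₂ y₂ := by
    obtain ⟨j, rfl⟩ : ∃ j, m = j + 3 := ⟨m - 3, by omega⟩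
    have hj : (1 : ℝ) ≤ 2 ^ j := one_le_pow₀ (by norm_num)
    have ej : (2 : ℝ) ^ (j + 3) = 2 ^ j * 8 := by rw [pow_add]; norm_num
    refine ⟨3 / 8, 7 / 8, 2 / 2 ^ (j + 3), 7 / 2 ^ (j + 3), by norm_num, by norm_num, by norm_num,
      by positivity, by gcongr; norm_num, ?_, by ring, ?_⟩
    · rw [div_le_one hN, ej]; linarith
    · rintro p hp ⟨⟨h1, h2⟩, h3, h4⟩
      rw [hP] at hp
      obtain ⟨n, hn, rfl⟩ := hp
      simp only at h1 h2 h3 h4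
      rw [psiMap_eq _ _ hn] at h3 h4
      rw [ej, lt_div_iff₀ (by positivity)] at h1
      rw [ej, div_lt_iff₀ (by positivity)] at h2
      have h3' := (div_lt_div_iff_of_pos_right hN).1 h3
      have h4' := (div_lt_div_iff_of_pos_right hN).1 h4
      apply box_exists j n
      · have : (3 * 2 ^ j : ℝ) < n := by linarith
        exact_mod_cast this
      · have : (n : ℝ) < 7 * 2 ^ j := by linarith
        exact_mod_cast this
      · exact_mod_cast h3'
      · exact_mod_cast h4'
  refine ⟨?_, hup, ?_⟩
  · have hub : ∀ A ∈ emptyBoxAreas P, A ≤ 5 / 2 * (1 / (2 : ℝ) ^ m) := by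
      rintro A ⟨x₁, y₁, x₂, y₂, h1, h2, h3, h4, h5, h6, h7, rfl⟩
      exact hup x₁ y₁ x₂ y₂ h1 h2 h3 h4 h5 h6 h7
    obtain ⟨x₁, y₁, x₂, y₂, h1, h2, h3, h4, h5, h6, h7, h8⟩ := hex
    have hmem : ∀ t, 0 < t → t ≤ y₁ - x₁ → t ≤ y₂ - x₂ →
        (y₁ - (x₁ + t)) * (y₂ - (x₂ + t)) ∈ emptyBoxAreas P := by
      intro t ht ht1 ht2
      refine ⟨x₁ + t, y₁, x₂ + t, y₂, by linarith, by linarith, h3, by linarith, by linarith, h6,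
        ?_, rfl⟩
      rintro p hp ⟨⟨g1, g2⟩, g3, g4⟩
      exact h8 p hp ⟨⟨by linarith, g2⟩, by linarith, g4⟩
    unfold disp
    apply le_antisymm
    · refine csSup_le ⟨_, hmem (min (y₁ - x₁) (y₂ - x₂)) ?_ (min_le_left _ _) (min_le_right _ _)⟩ hub
      exact lt_min (by linarith) (by linarith)
    · by_contra hcon
      push Not at hcon
      rw [← h7] at hcon
      set D := sSup (emptyBoxAreas P) with hD
      set t := min (min (y₁ - x₁) (y₂ - x₂)) (((y₁ - x₁) * (y₂ - x₂) - D) / 4) with ht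
      have ht0 : 0 < t := lt_min (lt_min (by linarith) (by linarith)) (by linarith)
      have ht1 : t ≤ y₁ - x₁ := (min_le_left _ _).trans (min_le_left _ _)
      have ht2 : t ≤ y₂ - x₂ := (min_le_left _ _).trans (min_le_right _ _)
      have ht3 : t ≤ ((y₁ - x₁) * (y₂ - x₂) - D) / 4 := min_le_right _ _
      have hle : (y₁ - (x₁ + t)) * (y₂ - (x₂ + t)) ≤ D := le_csSup ⟨_, hub⟩ (hmem t ht0 ht1 ht2)
      have hw : t * ((y₁ - x₁) + (y₂ - x₂)) ≤ t * 2 := by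
        apply mul_le_mul_of_nonneg_left _ ht0.le
        linarith
      nlinarith
  · obtain ⟨x₁, y₁, x₂, y₂, h1, h2, h3, h4, h5, h6, h7, h8⟩ := hex
    exact ⟨x₁, y₁, x₂, y₂, h1, h2.le, h3, h4, h5.le, h6, h7, h8⟩
end
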